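/- Let n > 1, k ≥ 3, and let g_1, …, g_n ∈ C_0^k(M^n, 𝔸) have compact support. If there exists f ∈ C^k(M^n, 𝔸) with compact support such that ∂̄_j f = g_j on M^n for j = 1, …, n, then f is given explicitly by f(x) = −∫_M E(y_1 − x_1) g_1(y_1, x^0) dV(y_1) for all x = (x_1, x^0) ∈ M^n, and consequently g_j(x) = −∂̄_j ( ∫_M E(y_1) g_1(y_1 + x_1, x^0) dV(y_1) ) for all j = 2, …, n and all x ∈ M^n. -/

import Mathlib

open MeasureTheory

noncomputable section

/-- A real alternative `*`-algebra of finite dimension `> 1`, with a fixed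
hypercomplex basis `v 0 = 1, v 1, …, v m` spanning the hypercomplex subspace `M`.
Multiplication is `ℝ`-bilinear (bundled as a linear map). -/
structure HCAlg (𝔸 : Type) [NormedAddCommGroup 𝔸] [NormedSpace ℝ 𝔸] (m : ℕ) : Type where
  mul : 𝔸 →ₗ[ℝ] 𝔸 →ₗ[ℝ] 𝔸
  one : 𝔸
  conj : 𝔸 →ₗ[ℝ] 𝔸
  findim : FiniteDimensional ℝ 𝔸
  dim_gt_one : 1 < Module.finrank ℝ 𝔸
  one_mul' : ∀ a, mul one a = a
  mul_one' : ∀ a, mul a one = a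
  alt_left : ∀ a b, mul a (mul a b) = mul (mul a a) b
  alt_right : ∀ a b, mul (mul b a) a = mul b (mul a a)
  conj_invol : ∀ a, conj (conj a) = a
  conj_mul' : ∀ a b, conj (mul a b) = mul (conj b) (conj a)
  conj_one : conj one = one
  hm : 1 ≤ m
  v : Fin (m + 1) → 𝔸
  v_indep : LinearIndependent ℝ v
  v_zero : v 0 = one
  v_trace : ∀ s, s ≠ 0 → v s + conj (v s) = 0
  v_norm : ∀ s, s ≠ 0 → mul (v s) (conj (v s)) = one
  v_anticomm : ∀ s t, s ≠ 0 → t ≠ 0 → s ≠ t → mul (v s) (v t) = -(mul (v t) (v s))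

variable {𝔸 : Type} [NormedAddCommGroup 𝔸] [NormedSpace ℝ 𝔸] {m n : ℕ}

/-- `M^n`, identified with `ℝ^{(m+1)n}` via the coordinates `x j s`. -/
abbrev Mn (n m : ℕ) := Fin n → Fin (m + 1) → ℝ

/-- Euclidean norm of a point of `M` (in coordinates). -/
def enormM (c : Fin (m + 1) → ℝ) : ℝ := Real.sqrt (∑ s, c s ^ 2)

/-- Euclidean norm of a point of `M^n` (in coordinates). -/
def enormMn (x : Mn n m) : ℝ := Real.sqrt (∑ j, ∑ s, x j s ^ 2)

/-- Partial derivative `∂f/∂x_{j,s}` for functions on `M^n`. -/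
def pd {E : Type} [NormedAddCommGroup E] [NormedSpace ℝ E]
    (f : Mn n m → E) (j : Fin n) (s : Fin (m + 1)) (x : Mn n m) : E :=
  fderiv ℝ f x (Pi.single j (Pi.single s 1))

/-- Partial derivative `∂f/∂x_s` for functions on `M`. -/
def pd1 {E : Type} [NormedAddCommGroup E] [NormedSpace ℝ E]
    (f : (Fin (m + 1) → ℝ) → E) (s : Fin (m + 1)) (x : Fin (m + 1) → ℝ) : E :=
  fderiv ℝ f x (Pi.single s 1)

/-- The Dirac (Cauchy–Riemann) operator `∂̄_j = ∑_s v_s ∂/∂x_{j,s}`. -/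
def dbar (H : HCAlg 𝔸 m) (f : Mn n m → 𝔸) (j : Fin n) (x : Mn n m) : 𝔸 :=
  ∑ s, H.mul (H.v s) (pd f j s x)

/-- The conjugated Dirac operator `∂_j = ∑_s v_s^c ∂/∂x_{j,s}`. -/
def dconj (H : HCAlg 𝔸 m) (f : Mn n m → 𝔸) (j : Fin n) (x : Mn n m) : 𝔸 :=
  ∑ s, H.mul (H.conj (H.v s)) (pd f j s x)

/-- The Laplacian `Δ_j = ∑_s ∂²/∂x_{j,s}²` in the `j`-th block of variables. -/
def lap {E : Type} [NormedAddCommGroup E] [NormedSpace ℝ E]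
    (f : Mn n m → E) (j : Fin n) (x : Mn n m) : E :=
  ∑ s, pd (pd f j s) j s x

/-- Surface area of the unit `(N-1)`-sphere in `ℝ^N`: `σ_N = 2 π^{N/2} / Γ(N/2)`. -/
def usigma (N : ℕ) : ℝ := 2 * Real.pi ^ ((N : ℝ) / 2) / Real.Gamma ((N : ℝ) / 2)

/-- Embedding of coordinates into the hypercomplex subspace `M ⊆ 𝔸`. -/
def embM (H : HCAlg 𝔸 m) (c : Fin (m + 1) → ℝ) : 𝔸 := ∑ s, c s • H.v s

/-- The Cauchy kernel `E(x) = σ_{m+1}⁻¹ x^c / |x|^{m+1}` on `M`. -/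
def CauchyE (H : HCAlg 𝔸 m) (c : Fin (m + 1) → ℝ) : 𝔸 :=
  (usigma (m + 1) * enormM c ^ (m + 1))⁻¹ • H.conj (embM H c)

/-- The Bochner–Martinelli kernel components `K_j(x) = σ_N⁻¹ x_j^c / |x|^N`, `N = (m+1)n`. -/
def Kker (H : HCAlg 𝔸 m) (n : ℕ) (j : Fin n) (x : Mn n m) : 𝔸 :=
  (usigma ((m + 1) * n) * enormMn x ^ ((m + 1) * n))⁻¹ • H.conj (embM H (x j))

/-- `Tsol g (x) = −∫_M E(y₁ − x₁) (g(y₁, x⁰)) dV(y₁)`. -/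
def Tsol (H : HCAlg 𝔸 m) (hn : 0 < n) (g : Mn n m → 𝔸) (x : Mn n m) : 𝔸 :=
  - ∫ y1 : Fin (m + 1) → ℝ,
      H.mul (CauchyE H (y1 - x ⟨0, hn⟩)) (g (Function.update x ⟨0, hn⟩ y1))

/-- `Fint g (x) = ∫_M E(y₁) (g(y₁ + x₁, x⁰)) dV(y₁)`. -/
def Fint (H : HCAlg 𝔸 m) (hn : 0 < n) (g : Mn n m → 𝔸) (x : Mn n m) : 𝔸 :=
  ∫ y1 : Fin (m + 1) → ℝ,
      H.mul (CauchyE H y1) (g (Function.update x ⟨0, hn⟩ (y1 + x ⟨0, hn⟩)))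


lemma HCAlg.conj_v_zero (H : HCAlg 𝔸 m) : H.conj (H.v 0) = H.one := by
  rw [H.v_zero, H.conj_one]

lemma HCAlg.conj_v_of_ne_zero (H : HCAlg 𝔸 m) {s : Fin (m + 1)} (hs : s ≠ 0) :
    H.conj (H.v s) = -H.v s :=
  (neg_eq_of_add_eq_zero_right (H.v_trace s hs)).symm

lemma HCAlg.conj_v_mul_v_self (H : HCAlg 𝔸 m) (s : Fin (m + 1)) :
    H.mul (H.conj (H.v s)) (H.v s) = H.one := by
  rcases eq_or_ne s 0 with rfl | hs
  · rw [H.conj_v_zero, H.v_zero, H.one_mul']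
  · have h := H.v_norm s hs
    rw [H.conj_v_of_ne_zero hs] at h ⊢
    simpa using h

lemma HCAlg.conj_v_mul_v_add_swap (H : HCAlg 𝔸 m) {r s : Fin (m + 1)} (hrs : r ≠ s) :
    H.mul (H.conj (H.v r)) (H.v s) + H.mul (H.conj (H.v s)) (H.v r) = 0 := by
  rcases eq_or_ne r 0 with rfl | hr
  · rw [H.conj_v_zero, H.conj_v_of_ne_zero hrs.symm, H.v_zero, H.one_mul', map_neg,
      LinearMap.neg_apply, H.mul_one', add_neg_cancel]
  rcases eq_or_ne s 0 with rfl | hs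
  · rw [H.conj_v_zero, H.conj_v_of_ne_zero hr, H.v_zero, H.one_mul', map_neg,
      LinearMap.neg_apply, H.mul_one', neg_add_cancel]
  · rw [H.conj_v_of_ne_zero hr, H.conj_v_of_ne_zero hs, map_neg, map_neg,
      LinearMap.neg_apply, LinearMap.neg_apply, H.v_anticomm r s hr hs hrs, neg_neg, add_neg_cancel]

lemma HCAlg.conj_embM_mul_embM (H : HCAlg 𝔸 m) (c : Fin (m + 1) → ℝ) :
    H.mul (H.conj (embM H c)) (embM H c) = (∑ s, c s ^ 2) • H.one := by
  set P : Fin (m + 1) → Fin (m + 1) → 𝔸 :=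
    fun r s => (c r * c s) • H.mul (H.conj (H.v r)) (H.v s) with hP
  have hexp : H.mul (H.conj (embM H c)) (embM H c) = ∑ r, ∑ s, P r s := by
    simp only [embM, map_sum, map_smul, LinearMap.sum_apply, LinearMap.smul_apply, hP,
      Finset.smul_sum, smul_smul]
    rw [Finset.sum_comm]
    simp only [mul_comm]
  have hsym : ∀ r s, P r s + P s r = if r = s then (2 * c r ^ 2) • H.one else 0 := by
    intro r s
    split_ifs with h
    · subst h
      simp only [hP, H.conj_v_mul_v_self, ← add_smul]
      congr 1
      ring
    · simp only [hP, mul_comm (c s) (c r), ← smul_add, H.conj_v_mul_v_add_swap h, smul_zero]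
  have htwo : (2 : ℝ) • H.mul (H.conj (embM H c)) (embM H c) =
      (2 : ℝ) • (∑ s, c s ^ 2) • H.one := by
    calc (2 : ℝ) • H.mul (H.conj (embM H c)) (embM H c)
        = (∑ r, ∑ s, P r s) + ∑ r, ∑ s, P s r := by
          rw [two_smul, Finset.sum_comm (f := fun r s => P s r), hexp]
      _ = ∑ r, ∑ s, (P r s + P s r) := by simp only [Finset.sum_add_distrib]
      _ = (2 : ℝ) • (∑ s, c s ^ 2) • H.one := by
          simp only [hsym, Finset.sum_ite_eq, Finset.mem_univ, if_true, Finset.sum_smul,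
            Finset.smul_sum, smul_smul]
  exact smul_right_injective 𝔸 (two_ne_zero' ℝ) htwo

/-- The conjugate of an element of the hypercomplex subspace is its trace minus itself. -/
lemma HCAlg.conj_embM (H : HCAlg 𝔸 m) (c : Fin (m + 1) → ℝ) :
    H.conj (embM H c) = (2 * c 0) • H.one - embM H c := by
  simp only [embM, Fin.sum_univ_succ, map_add, map_sum, map_smul, H.conj_one,
    H.conj_v_of_ne_zero (Fin.succ_ne_zero _), H.v_zero, smul_neg, Finset.sum_neg_distrib]
  module

lemma HCAlg.conj_embM_mul_mul (H : HCAlg 𝔸 m) (c : Fin (m + 1) → ℝ) (a : 𝔸) :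
    H.mul (H.conj (embM H c)) (H.mul (embM H c) a) = (∑ s, c s ^ 2) • a := by
  have h := congrArg (fun b => H.mul b a) (H.conj_embM_mul_embM c)
  simp only [H.conj_embM, map_sub, map_smul, LinearMap.sub_apply, LinearMap.smul_apply,
    H.one_mul', ← H.alt_left] at h ⊢
  exact h

lemma embM_single (H : HCAlg 𝔸 m) (s : Fin (m + 1)) : embM H (Pi.single s 1) = H.v s := by
  simp [embM, Pi.single_apply]

lemma HCAlg.conj_v_mul_v_mul (H : HCAlg 𝔸 m) (s : Fin (m + 1)) (a : 𝔸) :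
    H.mul (H.conj (H.v s)) (H.mul (H.v s) a) = a := by
  have h := H.conj_embM_mul_mul (Pi.single s 1) a
  simpa [embM_single, Pi.single_apply] using h

/-- The norm `√(|y|² + δ²)`, a smooth regularization of the Euclidean norm. -/
def regNorm (δ : ℝ) (y : Fin (m + 1) → ℝ) : ℝ := Real.sqrt (∑ s, y s ^ 2 + δ ^ 2)

lemma sum_sq_nonneg (y : Fin (m + 1) → ℝ) : 0 ≤ ∑ s, y s ^ 2 :=
  Finset.sum_nonneg fun _ _ => sq_nonneg _

lemma regNorm_sq (δ : ℝ) (y : Fin (m + 1) → ℝ) : regNorm δ y ^ 2 = ∑ s, y s ^ 2 + δ ^ 2 :=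
  Real.sq_sqrt (add_nonneg (sum_sq_nonneg y) (sq_nonneg δ))

lemma regNorm_pos {δ : ℝ} (hδ : δ ≠ 0) (y : Fin (m + 1) → ℝ) : 0 < regNorm δ y :=
  Real.sqrt_pos.2 (add_pos_of_nonneg_of_pos (sum_sq_nonneg y) (by positivity))

lemma enormM_le_regNorm (δ : ℝ) (y : Fin (m + 1) → ℝ) : enormM y ≤ regNorm δ y :=
  Real.sqrt_le_sqrt (le_add_of_nonneg_right (sq_nonneg δ))

lemma continuous_regNorm (δ : ℝ) : Continuous (regNorm δ : (Fin (m + 1) → ℝ) → ℝ) := by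
  unfold regNorm
  fun_prop

lemma regNorm_smul {δ : ℝ} (hδ : 0 ≤ δ) (y : Fin (m + 1) → ℝ) :
    regNorm δ (δ • y) = δ * regNorm 1 y := by
  unfold regNorm
  rw [← Real.sqrt_sq hδ, ← Real.sqrt_mul (sq_nonneg _), Real.sqrt_sq hδ]
  congr 1
  simp only [Pi.smul_apply, smul_eq_mul, mul_pow, ← Finset.mul_sum]
  ring

lemma norm_le_enormM (y : Fin (m + 1) → ℝ) : ‖y‖ ≤ enormM y := by
  refine (pi_norm_le_iff_of_nonneg (Real.sqrt_nonneg _)).2 fun s => ?_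
  rw [Real.norm_eq_abs, ← Real.sqrt_sq_eq_abs]
  exact Real.sqrt_le_sqrt
    (Finset.single_le_sum (f := fun s => y s ^ 2) (fun _ _ => sq_nonneg _) (Finset.mem_univ s))

lemma enormM_pos {y : Fin (m + 1) → ℝ} (hy : y ≠ 0) : 0 < enormM y :=
  (norm_pos_iff.2 hy).trans_le (norm_le_enormM y)

/-- The embedding of coordinates followed by conjugation, as a linear map. -/
def conjEmb (H : HCAlg 𝔸 m) : (Fin (m + 1) → ℝ) →ₗ[ℝ] 𝔸 :=
  H.conj ∘ₗ Fintype.linearCombination ℝ H.v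

lemma conjEmb_apply (H : HCAlg 𝔸 m) (y : Fin (m + 1) → ℝ) :
    conjEmb H y = H.conj (embM H y) := by
  simp [conjEmb, embM, Fintype.linearCombination_apply]

lemma continuous_conj_embM (H : HCAlg 𝔸 m) : Continuous fun y => H.conj (embM H y) := by
  simp only [← conjEmb_apply]
  exact (conjEmb H).continuous_of_finiteDimensional

lemma exists_norm_conj_embM_le (H : HCAlg 𝔸 m) :
    ∃ C, 0 ≤ C ∧ ∀ y, ‖H.conj (embM H y)‖ ≤ C * ‖y‖ := by
  refine ⟨‖(conjEmb H).toContinuousLinearMap‖, norm_nonneg _, fun y => ?_⟩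
  simpa only [conjEmb_apply, LinearMap.coe_toContinuousLinearMap'] using
    (conjEmb H).toContinuousLinearMap.le_opNorm y

/-- The multiplication of the algebra as a continuous bilinear map. -/
def HCAlg.mulL (H : HCAlg 𝔸 m) : 𝔸 →L[ℝ] 𝔸 →L[ℝ] 𝔸 :=
  haveI := H.findim
  H.mul.toContinuousBilinearMap

lemma HCAlg.mulL_apply (H : HCAlg 𝔸 m) (a b : 𝔸) : H.mulL a b = H.mul a b := rfl

/-- The Cauchy kernel with the Euclidean norm replaced by `regNorm δ`, and without the
normalizing constant. -/
def regKernel (H : HCAlg 𝔸 m) (δ : ℝ) (y : Fin (m + 1) → ℝ) : 𝔸 :=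
  (regNorm δ y ^ (m + 1))⁻¹ • H.conj (embM H y)

/-- The partial derivatives of `regKernel`. -/
def regKernelDeriv (H : HCAlg 𝔸 m) (δ : ℝ) (s : Fin (m + 1)) (y : Fin (m + 1) → ℝ) : 𝔸 :=
  (regNorm δ y ^ (m + 1))⁻¹ • H.conj (H.v s) -
    ((m + 1) * y s * (regNorm δ y ^ (m + 3))⁻¹) • H.conj (embM H y)

lemma continuous_regNorm_pow_inv {δ : ℝ} (hδ : δ ≠ 0) (N : ℕ) :
    Continuous fun y : Fin (m + 1) → ℝ => (regNorm δ y ^ N)⁻¹ :=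
  ((continuous_regNorm δ).pow N).inv₀ fun y => (pow_pos (regNorm_pos hδ y) N).ne'

lemma continuous_regKernel (H : HCAlg 𝔸 m) {δ : ℝ} (hδ : δ ≠ 0) :
    Continuous (regKernel H δ) :=
  (continuous_regNorm_pow_inv hδ _).smul (continuous_conj_embM H)

lemma continuous_regKernelDeriv (H : HCAlg 𝔸 m) {δ : ℝ} (hδ : δ ≠ 0) (s : Fin (m + 1)) :
    Continuous (regKernelDeriv H δ s) :=
  ((continuous_regNorm_pow_inv hδ _).smul continuous_const).sub
    (((continuous_const.mul (continuous_apply s)).mul (continuous_regNorm_pow_inv hδ _)).smul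
      (continuous_conj_embM H))

lemma hasLineDerivAt_regNorm {δ : ℝ} (hδ : δ ≠ 0) (s : Fin (m + 1)) (y : Fin (m + 1) → ℝ) :
    HasLineDerivAt ℝ (regNorm δ) (y s / regNorm δ y) y (Pi.single s 1) := by
  have hline : ∀ t : ℝ, ∑ r, (y + t • (Pi.single s 1 : Fin (m + 1) → ℝ)) r ^ 2 + δ ^ 2 =
      (∑ r, y r ^ 2 + δ ^ 2) + 2 * y s * t + t ^ 2 := by
    intro t
    have : ∀ r, (y + t • (Pi.single s 1 : Fin (m + 1) → ℝ)) r ^ 2 =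
        y r ^ 2 + if r = s then 2 * y s * t + t ^ 2 else 0 := by
      intro r
      by_cases h : r = s
      · subst h
        simp
        ring
      · simp [h]
    simp only [this, Finset.sum_add_distrib, Finset.sum_ite_eq', Finset.mem_univ, if_true]
    ring
  have hpoly : HasDerivAt (fun t : ℝ => (∑ r, y r ^ 2 + δ ^ 2) + 2 * y s * t + t ^ 2)
      (2 * y s) 0 := by
    have := (((hasDerivAt_id' (0 : ℝ)).const_mul (2 * y s)).const_add (∑ r, y r ^ 2 + δ ^ 2)).add
      (hasDerivAt_pow 2 (0 : ℝ))
    exact this.congr_deriv (by simp)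
  have hne : (∑ r, y r ^ 2 + δ ^ 2) + 2 * y s * 0 + (0 : ℝ) ^ 2 ≠ 0 := by
    have := sum_sq_nonneg y
    have : 0 < δ ^ 2 := by positivity
    simp
    positivity
  have h := hpoly.sqrt hne
  change HasDerivAt (fun t : ℝ =>
    Real.sqrt (∑ r, (y + t • (Pi.single s 1 : Fin (m + 1) → ℝ)) r ^ 2 + δ ^ 2)) _ 0
  simp only [hline]
  refine h.congr_deriv ?_
  simp only [mul_zero, add_zero, ne_eq, OfNat.ofNat_ne_zero, not_false_eq_true, zero_pow]
  rw [mul_div_mul_left _ _ two_ne_zero, regNorm]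

lemma hasLineDerivAt_regKernel (H : HCAlg 𝔸 m) {δ : ℝ} (hδ : δ ≠ 0) (s : Fin (m + 1))
    (y : Fin (m + 1) → ℝ) :
    HasLineDerivAt ℝ (regKernel H δ) (regKernelDeriv H δ s y) y (Pi.single s 1) := by
  have hR := regNorm_pos hδ y
  have h1 : HasDerivAt (fun t : ℝ => regNorm δ (y + t • Pi.single s (1 : ℝ)))
    (y s / regNorm δ y) 0 := hasLineDerivAt_regNorm hδ s y
  have h2 : HasDerivAt (fun t : ℝ => H.conj (embM H (y + t • Pi.single s (1 : ℝ))))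
      (H.conj (H.v s)) 0 := by
    have : ∀ t : ℝ, H.conj (embM H (y + t • Pi.single s (1 : ℝ))) =
        H.conj (embM H y) + t • H.conj (H.v s) := by
      intro t
      rw [← conjEmb_apply, map_add, map_smul, conjEmb_apply, conjEmb_apply, embM_single]
    simp only [this]
    simpa using ((hasDerivAt_id (0 : ℝ)).smul_const (H.conj (H.v s))).const_add
      (H.conj (embM H y))
  have h0 : y + (0 : ℝ) • Pi.single s (1 : ℝ) = y := by simp
  have h3 := ((h1.pow (m + 1)).inv (by rw [Pi.pow_apply, h0]; positivity)).smul h2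
  refine h3.congr_deriv ?_
  simp only [Pi.pow_apply, Pi.inv_apply, h0, regKernelDeriv, sub_eq_add_neg, ← neg_smul]
  congr 2
  push_cast
  field_simp
  ring

lemma sum_regKernelDeriv_mul (H : HCAlg 𝔸 m) {δ : ℝ} (hδ : δ ≠ 0) (y : Fin (m + 1) → ℝ)
    (a : 𝔸) :
    ∑ s, H.mul (regKernelDeriv H δ s y) (H.mul (H.v s) a) =
      ((m + 1) * δ ^ 2 * (regNorm δ y ^ (m + 3))⁻¹) • a := by
  have hR := regNorm_pos hδ y
  have hsum : ∑ s, y s • H.mul (H.conj (embM H y)) (H.mul (H.v s) a) =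
      (∑ s, y s ^ 2) • a := by
    rw [← H.conj_embM_mul_mul]
    conv_rhs => rw [show embM H y = ∑ s, y s • H.v s from rfl]
    simp only [embM, map_sum, map_smul, LinearMap.sum_apply, LinearMap.smul_apply]
  have hQ : ∑ s, y s ^ 2 = regNorm δ y ^ 2 - δ ^ 2 := by rw [regNorm_sq]; ring
  have hterm : ∀ s, H.mul (regKernelDeriv H δ s y) (H.mul (H.v s) a) =
      (regNorm δ y ^ (m + 1))⁻¹ • a - ((m + 1) * (regNorm δ y ^ (m + 3))⁻¹) •
        (y s • H.mul (H.conj (embM H y)) (H.mul (H.v s) a)) := by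
    intro s
    simp only [regKernelDeriv, map_sub, map_smul, LinearMap.sub_apply, LinearMap.smul_apply,
      H.conj_v_mul_v_mul, smul_smul]
    congr 2
    ring
  simp only [hterm, Finset.sum_sub_distrib]
  rw [← Finset.smul_sum (f := fun s => y s • H.mul (H.conj (embM H y)) (H.mul (H.v s) a)),
    hsum, hQ, Finset.sum_const, Finset.card_univ, Fintype.card_fin,
    ← Nat.cast_smul_eq_nsmul ℝ, smul_smul, smul_smul, ← sub_smul]
  congr 1
  push_cast
  field_simp
  ring

open Filter Topology in
lemma tendsto_div_sqrt_one_add_sq :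
    Tendsto (fun r : ℝ => r / Real.sqrt (r ^ 2 + 1)) atTop (𝓝 1) := by
  have h : Tendsto (fun r : ℝ => (Real.sqrt (1 + (r ^ 2)⁻¹))⁻¹) atTop (𝓝 1) := by
    have h0 : Tendsto (fun r : ℝ => 1 + (r ^ 2)⁻¹) atTop (𝓝 (1 + 0)) :=
      tendsto_const_nhds.add (tendsto_pow_atTop two_ne_zero).inv_tendsto_atTop
    simpa using (h0.sqrt).inv₀ (by simp)
  refine h.congr' ?_
  filter_upwards [eventually_gt_atTop 0] with r hr
  have : r ^ 2 + 1 = r ^ 2 * (1 + (r ^ 2)⁻¹) := by field_simp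
  rw [this, Real.sqrt_mul (sq_nonneg r), Real.sqrt_sq hr.le]
  field_simp

lemma hasDerivAt_div_sqrt_one_add_sq_pow (N : ℕ) (r : ℝ) :
    HasDerivAt (fun r : ℝ => (r / Real.sqrt (r ^ 2 + 1)) ^ (N + 1))
      (r ^ N * ((N + 1) * (Real.sqrt (r ^ 2 + 1) ^ (N + 3))⁻¹)) r := by
  have hpos : 0 < r ^ 2 + 1 := by positivity
  have hS : 0 < Real.sqrt (r ^ 2 + 1) := Real.sqrt_pos.2 hpos
  have hsq : Real.sqrt (r ^ 2 + 1) ^ 2 = r ^ 2 + 1 := Real.sq_sqrt hpos.le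
  have h := ((hasDerivAt_id' r).div (((hasDerivAt_pow 2 r).add_const 1).sqrt hpos.ne') hS.ne').pow
    (N + 1)
  refine h.congr_deriv ?_
  simp only [Pi.div_apply, Nat.add_sub_cancel, div_pow]
  generalize Real.sqrt (r ^ 2 + 1) = S at *
  have hr : r ^ 2 = S ^ 2 - 1 := by linarith
  push_cast
  field_simp
  rw [hr]
  ring

lemma integrable_and_integral_regNorm_pow_inv :
    Integrable (fun z : Fin (m + 1) → ℝ => (m + 1) * (regNorm 1 z ^ (m + 3))⁻¹) ∧
      ∫ z : Fin (m + 1) → ℝ, (m + 1) * (regNorm 1 z ^ (m + 3))⁻¹ = usigma (m + 1) := by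
  set φ : ℝ → ℝ := fun r => (m + 1) * (Real.sqrt (r ^ 2 + 1) ^ (m + 3))⁻¹ with hφ
  have hpull : (fun z : Fin (m + 1) → ℝ => (m + 1) * (regNorm 1 z ^ (m + 3))⁻¹) =
      (fun w : EuclideanSpace ℝ (Fin (m + 1)) => φ ‖w‖) ∘ WithLp.toLp 2 := by
    funext z
    simp only [hφ, Function.comp_apply, EuclideanSpace.norm_sq_eq, Real.norm_eq_abs, sq_abs,
      regNorm, one_pow]
  have hemb : MeasurableEmbedding (WithLp.toLp 2 : (Fin (m + 1) → ℝ) → _) :=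
    (MeasurableEquiv.toLp 2 (Fin (m + 1) → ℝ)).measurableEmbedding
  have hmp := PiLp.volume_preserving_toLp (Fin (m + 1))
  have hnonneg : ∀ r ∈ Set.Ioi (0 : ℝ), 0 ≤ r ^ m * φ r := fun r hr => by
    have : (0 : ℝ) < r := hr
    simp only [hφ]
    positivity
  have hlim := tendsto_div_sqrt_one_add_sq.pow (m + 1)
  rw [one_pow] at hlim
  have hint := integrableOn_Ioi_deriv_of_nonneg'
    (fun r _ => hasDerivAt_div_sqrt_one_add_sq_pow m r) hnonneg hlim
  have hval := integral_Ioi_of_hasDerivAt_of_nonneg'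
    (fun r _ => hasDerivAt_div_sqrt_one_add_sq_pow m r) hnonneg hlim
  constructor
  · rw [hpull, hmp.integrable_comp_emb hemb, integrable_fun_norm_addHaar]
    simpa [φ] using hint
  · rw [hpull]
    simp only [Function.comp_def]
    rw [hmp.integral_comp hemb (fun w => φ ‖w‖), integral_fun_norm_addHaar]
    simp only [finrank_euclideanSpace, Fintype.card_fin, Nat.add_sub_cancel, smul_eq_mul]
    rw [hval, Measure.real, EuclideanSpace.volume_ball, Fintype.card_fin]
    have hG : 0 < Real.Gamma (((m + 1 : ℕ) : ℝ) / 2) := Real.Gamma_pos_of_pos (by positivity)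
    have hpi : Real.sqrt Real.pi ^ (m + 1) = Real.pi ^ (((m + 1 : ℕ) : ℝ) / 2) := by
      rw [Real.sqrt_eq_rpow, ← Real.rpow_natCast, ← Real.rpow_mul Real.pi_pos.le]
      congr 1
      ring
    rw [hpi, Real.Gamma_add_one (by positivity), ENNReal.ofReal_one, one_pow, one_mul,
      ENNReal.toReal_ofReal (by positivity), usigma]
    simp only [nsmul_eq_mul]
    push_cast at hG ⊢
    simp
    field_simp

/-- The Cauchy-Riemann operator `∑ s, v_s ∂/∂x_s` for functions on `M`. -/
def dbar1 (H : HCAlg 𝔸 m) (f : (Fin (m + 1) → ℝ) → 𝔸) (y : Fin (m + 1) → ℝ) : 𝔸 :=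
  ∑ s, H.mul (H.v s) (pd1 f s y)

lemma continuous_pd1 {f : (Fin (m + 1) → ℝ) → 𝔸} (hf : ContDiff ℝ 1 f) (s : Fin (m + 1)) :
    Continuous (pd1 f s) :=
  (hf.continuous_fderiv one_ne_zero).clm_apply continuous_const

lemma continuous_dbar1 (H : HCAlg 𝔸 m) {f : (Fin (m + 1) → ℝ) → 𝔸} (hf : ContDiff ℝ 1 f) :
    Continuous (dbar1 H f) :=
  continuous_finsetSum _ fun s _ => (H.mulL (H.v s)).continuous.comp (continuous_pd1 hf s)

lemma hasCompactSupport_dbar1 (H : HCAlg 𝔸 m) {f : (Fin (m + 1) → ℝ) → 𝔸}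
    (hf : HasCompactSupport f) : HasCompactSupport (dbar1 H f) :=
  (hf.fderiv ℝ).comp_left
    (g := fun L : (Fin (m + 1) → ℝ) →L[ℝ] 𝔸 => ∑ s, H.mul (H.v s) (L (Pi.single s 1)))
    (by simp)

lemma integral_regKernel_mul_dbar1 (H : HCAlg 𝔸 m) {f : (Fin (m + 1) → ℝ) → 𝔸}
    (hf : ContDiff ℝ 1 f) (hfs : HasCompactSupport f) {δ : ℝ} (hδ : δ ≠ 0) :
    ∫ y, H.mul (regKernel H δ y) (dbar1 H f y) =
      -∫ y, ((m + 1) * δ ^ 2 * (regNorm δ y ^ (m + 3))⁻¹) • f y := by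
  have hE := continuous_regKernel H hδ
  have hmul : ∀ s, Continuous fun y => H.mulL (H.v s) (f y) :=
    fun s => (H.mulL (H.v s)).continuous.comp hf.continuous
  have hmul' : ∀ s, Continuous fun y => H.mulL (H.v s) (pd1 f s y) :=
    fun s => (H.mulL (H.v s)).continuous.comp (continuous_pd1 hf s)
  have hint' : ∀ s, Integrable fun y => H.mulL (regKernel H δ y) (H.mulL (H.v s) (pd1 f s y)) := by
    intro s
    refine ((H.mulL.continuous.comp hE).clm_apply (hmul' s)).integrable_of_hasCompactSupport ?_
    refine (hfs.fderiv_apply ℝ (Pi.single s 1)).mono fun y hy h0 => hy ?_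
    simp only [pd1, h0, map_zero]
  have hintE : ∀ s, Integrable fun y =>
      H.mulL (regKernelDeriv H δ s y) (H.mulL (H.v s) (f y)) := by
    intro s
    refine ((H.mulL.continuous.comp (continuous_regKernelDeriv H hδ s)).clm_apply
      (hmul s)).integrable_of_hasCompactSupport ?_
    refine hfs.mono fun y hy h0 => hy ?_
    simp only [h0, map_zero]
  have hint : ∀ s, Integrable fun y => H.mulL (regKernel H δ y) (H.mulL (H.v s) (f y)) := by
    intro s
    refine ((H.mulL.continuous.comp hE).clm_apply (hmul s)).integrable_of_hasCompactSupport ?_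
    refine hfs.mono fun y hy h0 => hy ?_
    simp only [h0, map_zero]
  have hparts : ∀ s, ∫ y, H.mulL (regKernel H δ y) (H.mulL (H.v s) (pd1 f s y)) =
      -∫ y, H.mulL (regKernelDeriv H δ s y) (H.mulL (H.v s) (f y)) := fun s =>
    integral_bilinear_hasLineDerivAt_right_eq_neg_left_of_integrable (v := Pi.single s 1)
      (hintE s) (hint' s) (hint s) (fun y _ => hasLineDerivAt_regKernel H hδ s y)
      (fun y _ => ((H.mulL (H.v s)).hasFDerivAt.comp y
        (hf.differentiable one_ne_zero y).hasFDerivAt).hasLineDerivAt (Pi.single s 1))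
  calc ∫ y, H.mul (regKernel H δ y) (dbar1 H f y)
      = ∫ y, ∑ s, H.mulL (regKernel H δ y) (H.mulL (H.v s) (pd1 f s y)) := by
        simp only [dbar1, map_sum, H.mulL_apply]
    _ = -∫ y, ∑ s, H.mulL (regKernelDeriv H δ s y) (H.mulL (H.v s) (f y)) := by
        rw [integral_finsetSum _ fun s _ => hint' s, integral_finsetSum _ fun s _ => hintE s,
          ← Finset.sum_neg_distrib]
        exact Finset.sum_congr rfl fun s _ => hparts s
    _ = -∫ y, ((m + 1) * δ ^ 2 * (regNorm δ y ^ (m + 3))⁻¹) • f y := by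
        simp only [H.mulL_apply, sum_regKernelDeriv_mul H hδ]

lemma integral_regNorm_smul_eq_comp_smul (f : (Fin (m + 1) → ℝ) → 𝔸) {δ : ℝ} (hδ : 0 < δ) :
    ∫ y, ((m + 1) * δ ^ 2 * (regNorm δ y ^ (m + 3))⁻¹) • f y =
      ∫ z, ((m + 1) * (regNorm 1 z ^ (m + 3))⁻¹) • f (δ • z) := by
  have h := Measure.integral_comp_smul (volume : Measure (Fin (m + 1) → ℝ))
    (fun y => ((m + 1) * δ ^ 2 * (regNorm δ y ^ (m + 3))⁻¹) • f y) δ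
  rw [Module.finrank_fin_fun, abs_of_pos (by positivity), eq_inv_smul_iff₀ (by positivity),
    ← integral_smul] at h
  rw [← h]
  refine integral_congr_ae (.of_forall fun z => ?_)
  have hR := regNorm_pos one_ne_zero z
  simp only [regNorm_smul hδ.le, smul_smul]
  congr 1
  field_simp
  ring

open Filter Topology in
lemma tendsto_integral_regNorm_smul [CompleteSpace 𝔸] {f : (Fin (m + 1) → ℝ) → 𝔸}
    (hf : Continuous f) (hfs : HasCompactSupport f) :
    Tendsto (fun δ : ℝ => ∫ y, ((m + 1) * δ ^ 2 * (regNorm δ y ^ (m + 3))⁻¹) • f y)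
      (𝓝[>] 0) (𝓝 (usigma (m + 1) • f 0)) := by
  obtain ⟨hint, hval⟩ := integrable_and_integral_regNorm_pow_inv (m := m)
  obtain ⟨C, hC⟩ := hfs.exists_bound_of_continuous hf
  rw [← hval, ← integral_smul_const]
  refine Tendsto.congr' (f₁ := fun δ : ℝ =>
    ∫ z, ((m + 1) * (regNorm 1 z ^ (m + 3))⁻¹) • f (δ • z)) ?_ ?_
  · filter_upwards [self_mem_nhdsWithin] with δ hδ
    exact (integral_regNorm_smul_eq_comp_smul f hδ).symm
  refine tendsto_integral_filter_of_dominated_convergence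
    (fun z => (m + 1) * (regNorm 1 z ^ (m + 3))⁻¹ * C) (.of_forall fun δ => ?_)
    (.of_forall fun δ => .of_forall fun z => ?_) (hint.mul_const C) (.of_forall fun z => ?_)
  · exact ((continuous_const.mul (continuous_regNorm_pow_inv one_ne_zero _)).smul
      (hf.comp (continuous_const_smul δ))).aestronglyMeasurable
  · have hR := regNorm_pos one_ne_zero z
    rw [norm_smul, Real.norm_of_nonneg (by positivity)]
    exact mul_le_mul_of_nonneg_left (hC _) (by positivity)
  · have h : Continuous fun δ : ℝ => f (δ • z) := hf.comp (continuous_id.smul continuous_const)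
    have h0 := h.tendsto 0
    rw [zero_smul] at h0
    exact (h0.mono_left nhdsWithin_le_nhds).const_smul _

lemma integrable_enormM_pow_inv_smul (H : HCAlg 𝔸 m) {g : (Fin (m + 1) → ℝ) → 𝔸}
    (hg : Continuous g) (hgs : HasCompactSupport g) :
    Integrable fun y => (enormM y ^ (m + 1))⁻¹ • H.mul (H.conj (embM H y)) (g y) := by
  obtain ⟨C, hC⟩ := hgs.exists_bound_of_continuous hg
  obtain ⟨A, hA0, hA⟩ := exists_norm_conj_embM_le H
  have hC0 : 0 ≤ C := (norm_nonneg _).trans (hC 0)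
  have hprod : Continuous fun y => H.mulL (H.conj (embM H y)) (g y) :=
    (H.mulL.continuous.comp (continuous_conj_embM H)).clm_apply hg
  have henorm : Continuous (enormM : (Fin (m + 1) → ℝ) → ℝ) := by
    unfold enormM
    fun_prop
  have hloc : LocallyIntegrable
      (fun y => (enormM y ^ (m + 1))⁻¹ • H.mulL (H.conj (embM H y)) (g y)) := by
    refine locallyIntegrable_of_norm_le_rpow (μ := volume) (C := ‖H.mulL‖ * A * C) (α := m)
      (by simp) (by simp) (.of_forall fun y => ?_)
      ((henorm.pow _).measurable.inv.aestronglyMeasurable.smul hprod.aestronglyMeasurable)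
    rcases eq_or_ne y 0 with rfl | hy
    · have : H.conj (embM H (0 : Fin (m + 1) → ℝ)) = 0 := by rw [← conjEmb_apply, map_zero]
      rw [this, map_zero, zero_apply, smul_zero, norm_zero]
      positivity
    · have hn : 0 < ‖y‖ := norm_pos_iff.2 hy
      have he : 0 < enormM y := enormM_pos hy
      rw [norm_smul, Real.norm_of_nonneg (by positivity), Real.rpow_neg hn.le, Real.rpow_natCast]
      calc (enormM y ^ (m + 1))⁻¹ * ‖H.mulL (H.conj (embM H y)) (g y)‖
          ≤ (‖y‖ ^ (m + 1))⁻¹ * (‖H.mulL‖ * (A * ‖y‖) * C) := by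
            gcongr
            · exact norm_le_enormM y
            · refine (H.mulL.le_opNorm₂ _ _).trans ?_
              gcongr
              · exact hA y
              · exact hC y
        _ = ‖H.mulL‖ * A * C * (‖y‖ ^ m)⁻¹ := by
            rw [pow_succ]
            field_simp
  refine (integrableOn_iff_integrable_of_support_subset (s := tsupport g) fun y hy => ?_).1
    (hloc.integrableOn_isCompact hgs)
  refine subset_tsupport g fun h0 => hy ?_
  simp only [h0, map_zero, smul_zero]

open Filter Topology in
lemma tendsto_integral_regKernel_mul (H : HCAlg 𝔸 m) {g : (Fin (m + 1) → ℝ) → 𝔸}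
    (hg : Continuous g) (hgs : HasCompactSupport g) :
    Tendsto (fun δ : ℝ => ∫ y, H.mul (regKernel H δ y) (g y)) (𝓝[>] 0)
      (𝓝 (∫ y, (enormM y ^ (m + 1))⁻¹ • H.mul (H.conj (embM H y)) (g y))) := by
  have hzero : H.mul (H.conj (embM H (0 : Fin (m + 1) → ℝ))) = 0 := by
    rw [← conjEmb_apply, map_zero, map_zero]
  refine tendsto_integral_filter_of_dominated_convergence _ ?_ ?_
    (integrable_enormM_pow_inv_smul H hg hgs).norm (.of_forall fun y => ?_)
  · filter_upwards [self_mem_nhdsWithin] with δ hδ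
    exact ((H.mulL.continuous.comp (continuous_regKernel H (ne_of_gt hδ))).clm_apply
      hg).aestronglyMeasurable
  · refine .of_forall fun δ => .of_forall fun y => ?_
    simp only [regKernel, map_smul, LinearMap.smul_apply]
    rcases eq_or_ne y 0 with rfl | hy
    · simp [hzero]
    · have he := enormM_pos hy
      have hR := he.trans_le (enormM_le_regNorm δ y)
      rw [norm_smul, norm_smul, Real.norm_of_nonneg (by positivity),
        Real.norm_of_nonneg (by positivity)]
      gcongr
      exact enormM_le_regNorm δ y
  · simp only [regKernel, map_smul, LinearMap.smul_apply]
    rcases eq_or_ne y 0 with rfl | hy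
    · simp [hzero]
    · have he := enormM_pos hy
      have hcont : Continuous fun δ : ℝ => regNorm δ y := by
        unfold regNorm
        fun_prop
      have h0 := hcont.tendsto 0
      have hval : regNorm 0 y = enormM y := by simp [regNorm, enormM]
      rw [hval] at h0
      exact (((h0.mono_left nhdsWithin_le_nhds).pow (m + 1)).inv₀ (by positivity)).smul_const _

lemma usigma_pos (N : ℕ) : 0 < usigma (N + 1) := by
  have := Real.Gamma_pos_of_pos (show (0 : ℝ) < ((N + 1 : ℕ) : ℝ) / 2 by positivity)
  have := Real.pi_pos
  unfold usigma
  positivity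

/-- The Cauchy-Pompeiu formula at the origin for compactly supported functions. -/
theorem integral_CauchyE_mul_dbar1 (H : HCAlg 𝔸 m) {f : (Fin (m + 1) → ℝ) → 𝔸}
    (hf : ContDiff ℝ 1 f) (hfs : HasCompactSupport f) :
    ∫ y, H.mul (CauchyE H y) (dbar1 H f y) = -f 0 := by
  have := H.findim
  have : CompleteSpace 𝔸 := FiniteDimensional.complete ℝ 𝔸
  have h1 := tendsto_integral_regKernel_mul H (continuous_dbar1 H hf)
    (hasCompactSupport_dbar1 H hfs)
  have h2 := (tendsto_integral_regNorm_smul hf.continuous hfs).neg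
  have h3 := tendsto_nhds_unique_of_eventuallyEq h1 h2 (by
    filter_upwards [self_mem_nhdsWithin] with δ hδ
    exact integral_regKernel_mul_dbar1 H hf hfs (ne_of_gt hδ))
  have hσ := (usigma_pos m).ne'
  simp only [CauchyE, map_smul, LinearMap.smul_apply, mul_inv, mul_smul]
  rw [integral_smul, h3, smul_neg, inv_smul_smul₀ hσ]

/-- Restricting to the line through `x` in the `i`-th block intertwines `dbar` and `dbar1`. -/
lemma dbar1_comp_update (H : HCAlg 𝔸 m) {f : Mn n m → 𝔸} (hf : Differentiable ℝ f)
    (i : Fin n) (x : Mn n m) (y : Fin (m + 1) → ℝ) :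
    dbar1 H (fun y => f (Function.update x i (y + x i))) y =
      dbar H f i (Function.update x i (y + x i)) := by
  have hadd : HasFDerivAt (fun y => y + x i) (ContinuousLinearMap.id ℝ (Fin (m + 1) → ℝ)) y :=
    (hasFDerivAt_id y).add_const (x i)
  have hline := HasFDerivAt.comp y (g := Function.update x i)
    (hasFDerivAt_update x (y + x i)) hadd
  have hcomp := (hf (Function.update x i (y + x i))).hasFDerivAt.comp y hline
  refine Finset.sum_congr rfl fun s _ => ?_
  congr 1
  refine (DFunLike.congr_fun hcomp.fderiv (Pi.single s 1)).trans
    (congrArg (fderiv ℝ f (Function.update x i (y + x i))) ?_)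
  funext j
  rcases eq_or_ne j i with rfl | hj
  · simp
  · simp [hj]

lemma Fint_dbar_eq_neg (H : HCAlg 𝔸 m) (hn : 0 < n) {f : Mn n m → 𝔸} (hf : ContDiff ℝ 1 f)
    (hfs : HasCompactSupport f) (x : Mn n m) :
    Fint H hn (dbar H f ⟨0, hn⟩) x = -f x := by
  set i : Fin n := ⟨0, hn⟩
  have hline : ContDiff ℝ 1 fun y : Fin (m + 1) → ℝ => Function.update x i (y + x i) :=
    (contDiff_update 1 x i).comp (contDiff_id.add contDiff_const)
  have hemb : Topology.IsClosedEmbedding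
      fun y : Fin (m + 1) → ℝ => Function.update x i (y + x i) :=
    Function.LeftInverse.isClosedEmbedding (f := fun z : Mn n m => z i - x i)
      (fun y => by simp) (by fun_prop) hline.continuous
  have h := integral_CauchyE_mul_dbar1 H (hf.comp hline) (hfs.comp_isClosedEmbedding hemb)
  simp only [Function.comp_def, dbar1_comp_update H (hf.differentiable one_ne_zero)] at h
  simpa [Fint, i] using h

lemma Tsol_eq_neg_Fint (H : HCAlg 𝔸 m) (hn : 0 < n) (g : Mn n m → 𝔸) (x : Mn n m) :
    Tsol H hn g x = -Fint H hn g x := by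
  rw [Tsol, Fint, ← integral_add_right_eq_self
    (fun y => H.mul (CauchyE H (y - x ⟨0, hn⟩)) (g (Function.update x ⟨0, hn⟩ y))) (x ⟨0, hn⟩)]
  simp only [add_sub_cancel_right]

/-- (i) ⇒ (ii) of Theorem 5.2: a compactly supported `C^k` solution of `∂̄_j f = g_j` is
given by `f(x) = −∫_M E(y₁ − x₁) g₁(y₁, x⁰) dV(y₁)`, and consequently
`g_j(x) = −∂̄_j (∫_M E(y₁) g₁(y₁ + x₁, x⁰) dV(y₁))` for all `j = 2, …, n`. -/
theorem solution_implies_explicit_formula (H : HCAlg 𝔸 m) (hn : 1 < n) (k : ℕ) (hk : 3 ≤ k)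
    (g : Fin n → Mn n m → 𝔸)
    (hg : ∀ j, ContDiff ℝ k (g j)) (hgs : ∀ j, HasCompactSupport (g j))
    (f : Mn n m → 𝔸) (hf : ContDiff ℝ k f) (hfs : HasCompactSupport f)
    (hsol : ∀ (j : Fin n) (x : Mn n m), dbar H f j x = g j x) :
    (∀ x : Mn n m, f x = Tsol H (by omega) (g ⟨0, by omega⟩) x) ∧
    ∀ j : Fin n, j ≠ ⟨0, by omega⟩ → ∀ x : Mn n m,
      g j x = - dbar H (Fint H (by omega) (g ⟨0, by omega⟩)) j x := by
  have hf1 : ContDiff ℝ 1 f := hf.of_le (by exact_mod_cast (by omega : 1 ≤ k))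
  have hg0 : dbar H f ⟨0, by omega⟩ = g ⟨0, by omega⟩ := funext (hsol _)
  have hF : ∀ x, Fint H (by omega) (g ⟨0, by omega⟩) x = -f x := by
    rw [← hg0]
    exact Fint_dbar_eq_neg H _ hf1 hfs
  refine ⟨fun x => by rw [Tsol_eq_neg_Fint, hF, neg_neg], fun j _ x => ?_⟩
  rw [funext hF, ← hsol j x]
  simp only [dbar, pd, fderiv_fun_neg, neg_apply, map_neg,
    Finset.sum_neg_distrib, neg_neg]

end
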